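/- Let n, n̄ : ℝ³ ∖ {0} → ℝ be smooth and homogeneous of degree 0, and for x ∈ S² define the 3×3 matrix M(x) = H_n(x) − (1/2)(Δn)(x) P(x) + (1/2)( J_x H_{n̄}(x) − H_{n̄}(x) J_x ), where Δ is the ambient Euclidean Laplacian. Then ∫_{S²} tr( M(x) M(x)ᵀ ) dS = (1/2) ∫_{S²} ( n · Δ(Δn) + n̄ · Δ(Δn̄) ) dS. (M realizes the symmetric traceless 2-tensor N_{AB} = ∇_A∇_B n − (1/2)σ_{AB}Δ_{S²}n + (1/2)(ε_A{}^E∇_E∇_B n̄ + ε_B{}^E∇_E∇_A n̄) on the round sphere with potentials n, n̄, and on degree-0 homogeneous functions Δ_{S²}(Δ_{S²}+2) is realized by the ambient bi-Laplacian Δ²; so this is the identity ∫_{S²} N_{AB}N^{AB} = (1/2)∫_{S²} [ n Δ_{S²}(Δ_{S²}+2)n + n̄ Δ_{S²}(Δ_{S²}+2)n̄ ].) -/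

import Mathlib

open MeasureTheory Matrix

noncomputable section

/-- Euclidean 3-space. -/
abbrev E3 := EuclideanSpace ℝ (Fin 3)

/-- The Euclidean inner product on coordinate vectors. -/
def dot3 (a b : Fin 3 → ℝ) : ℝ := ∑ i, a i * b i

/-- The cross product in ℝ³. -/
def cross3 (a b : Fin 3 → ℝ) : Fin 3 → ℝ :=
  ![a 1 * b 2 - a 2 * b 1, a 2 * b 0 - a 0 * b 2, a 0 * b 1 - a 1 * b 0]

/-- Standard basis vectors of E3. -/
def e3 (i : Fin 3) : E3 := EuclideanSpace.single i 1

/-- The ambient gradient of `u : ℝ³ → ℝ` (as a coordinate vector). -/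
def grad3 (u : E3 → ℝ) (x : E3) : Fin 3 → ℝ := fun i => fderiv ℝ u x (e3 i)

/-- The ambient Hessian matrix of `u : ℝ³ → ℝ`. -/
def hess3 (u : E3 → ℝ) (x : E3) : Matrix (Fin 3) (Fin 3) ℝ :=
  Matrix.of fun i j => iteratedFDeriv ℝ 2 u x ![e3 i, e3 j]

/-- The ambient Euclidean Laplacian Δu = Σᵢ ∂²u/∂xᵢ². -/
def lap3 (u : E3 → ℝ) : E3 → ℝ := fun x => ∑ i, hess3 u x i i

/-- The orthogonal projection P(x) = I - x xᵀ onto the tangent plane of S² at x. -/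
def proj3 (x : E3) : Matrix (Fin 3) (Fin 3) ℝ := 1 - Matrix.of fun i j => x i * x j

/-- The projected ambient Hessian H_u(x) = P(x) (D²u)(x) P(x), realizing the intrinsic
Hessian on S² of the restriction of a degree-0 homogeneous function. -/
def hessS (u : E3 → ℝ) (x : E3) : Matrix (Fin 3) (Fin 3) ℝ := proj3 x * hess3 u x * proj3 x

/-- The matrix of the linear map `w ↦ x × w` on ℝ³. -/
def crossMat (x : E3) : Matrix (Fin 3) (Fin 3) ℝ :=
  !![0, -x 2, x 1; x 2, 0, -x 0; -x 1, x 0, 0]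

/-- `u` is (positively) homogeneous of degree 0 away from the origin. -/
def Homog0 (u : E3 → ℝ) : Prop := ∀ c : ℝ, 0 < c → ∀ x : E3, x ≠ 0 → u (c • x) = u x

/-- The matrix realizing the symmetric traceless 2-tensor with closed potential `n`
and co-closed potential `nb` on the round sphere. -/
def newsMat (n nb : E3 → ℝ) (x : E3) : Matrix (Fin 3) (Fin 3) ℝ :=
  hessS n x - (1 / 2 * lap3 n x) • proj3 x
    + (1 / 2 : ℝ) • (crossMat x * hessS nb x - hessS nb x * crossMat x)

/-- The unit sphere of `E3` is compact. -/
lemma isCompact_unitSphere : IsCompact (Metric.sphere (0 : E3) 1) := isCompact_sphere _ _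

lemma ne_zero_of_mem_unitSphere {x : E3} (hx : x ∈ Metric.sphere (0 : E3) 1) : x ≠ 0 :=
  Metric.ne_of_mem_sphere hx one_ne_zero

lemma sum_sq_of_mem_unitSphere {x : E3} (hx : x ∈ Metric.sphere (0 : E3) 1) :
    x 0 ^ 2 + x 1 ^ 2 + x 2 ^ 2 = 1 := by
  have h : ‖x‖ = 1 := by simpa using hx
  have h2 := EuclideanSpace.real_norm_sq_eq x
  rw [h, Fin.sum_univ_three] at h2
  linarith

/-- Spherical coordinates on the unit sphere. -/
def sphericalCoord (p : ℝ × ℝ) : E3 :=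
  !₂[Real.sin p.1 * Real.cos p.2, Real.sin p.1 * Real.sin p.2, Real.cos p.1]

lemma contDiff_sphericalCoord : ContDiff ℝ 1 sphericalCoord := by
  rw [contDiff_euclidean]
  intro i
  fin_cases i <;> simp [sphericalCoord] <;> fun_prop

lemma unitSphere_subset_image_sphericalCoord :
    Metric.sphere (0 : E3) 1 ⊆
      sphericalCoord '' (Set.Icc 0 Real.pi ×ˢ Set.Icc (-Real.pi) Real.pi) := by
  intro x hx
  have h := sum_sq_of_mem_unitSphere hx
  set z : ℂ := ⟨x 0, x 1⟩ with hz
  have hs : Real.sin (Real.arccos (x 2)) = ‖z‖ := by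
    rw [Real.sin_arccos, Complex.norm_def, Complex.normSq_mk]
    congr 1
    linarith
  refine ⟨(Real.arccos (x 2), Complex.arg z),
    ⟨⟨Real.arccos_nonneg _, Real.arccos_le_pi _⟩,
      ⟨(Complex.neg_pi_lt_arg z).le, Complex.arg_le_pi z⟩⟩, ?_⟩
  ext i
  fin_cases i
  · simp [sphericalCoord, hs, Complex.norm_mul_cos_arg, hz]
  · simp [sphericalCoord, hs, Complex.norm_mul_sin_arg, hz]
  · simpa [sphericalCoord] using Real.cos_arccos (x := x 2)
      (by nlinarith [sq_nonneg (x 0), sq_nonneg (x 1)])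
      (by nlinarith [sq_nonneg (x 0), sq_nonneg (x 1)])

lemma hausdorffMeasure_unitSphere_lt_top : μH[2] (Metric.sphere (0 : E3) 1) < ⊤ := by
  have hc : IsCompact (Set.Icc (0 : ℝ) Real.pi ×ˢ Set.Icc (-Real.pi) Real.pi) :=
    isCompact_Icc.prod isCompact_Icc
  obtain ⟨K, hK⟩ := (contDiff_sphericalCoord.contDiffOn
    (s := Set.Icc (0 : ℝ) Real.pi ×ˢ Set.Icc (-Real.pi) Real.pi)).exists_lipschitzOnWith
    one_ne_zero ((convex_Icc _ _).prod (convex_Icc _ _)) hc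
  refine (measure_mono unitSphere_subset_image_sphericalCoord).trans_lt
    ((hK.hausdorffMeasure_image_le zero_le_two).trans_lt ?_)
  rw [hausdorffMeasure_prod_real]
  exact ENNReal.mul_lt_top (ENNReal.rpow_lt_top_of_nonneg zero_le_two ENNReal.coe_ne_top)
    hc.measure_lt_top

instance : IsFiniteMeasure (μH[2].restrict (Metric.sphere (0 : E3) 1)) :=
  ⟨by simpa using hausdorffMeasure_unitSphere_lt_top⟩

lemma integrableOn_unitSphere {f : E3 → ℝ} (hf : ContinuousOn f {0}ᶜ) :
    IntegrableOn f (Metric.sphere (0 : E3) 1) μH[2] := by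
  have hf' : ContinuousOn f (Metric.sphere (0 : E3) 1) :=
    hf.mono fun x hx => ne_zero_of_mem_unitSphere hx
  obtain ⟨C, hC⟩ := isCompact_unitSphere.exists_bound_of_continuousOn hf'
  exact IntegrableOn.of_bound hausdorffMeasure_unitSphere_lt_top
    (hf'.aestronglyMeasurable Metric.isClosed_sphere.measurableSet) C
    (ae_restrict_of_forall_mem Metric.isClosed_sphere.measurableSet hC)

/-- The generator `x ↦ x_a e_k - x_k e_a` of the rotations in the `(a, k)` coordinate plane. -/
def rotGen (a k : Fin 3) (x : E3) : E3 := x a • e3 k - x k • e3 a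

/-- Rotation by the angle `t` in the `(a, k)` coordinate plane. -/
def planeRot (a k : Fin 3) (t : ℝ) : E3 →ₗ[ℝ] E3 where
  toFun x := x + (Real.cos t - 1) • (x a • e3 a + x k • e3 k) + Real.sin t • rotGen a k x
  map_add' x y := by
    simp only [rotGen, PiLp.add_apply]
    module
  map_smul' c x := by
    simp only [rotGen, PiLp.smul_apply, RingHom.id_apply, smul_eq_mul]
    module

lemma planeRot_apply (a k : Fin 3) (t : ℝ) (x : E3) :
    planeRot a k t x =
      x + (Real.cos t - 1) • (x a • e3 a + x k • e3 k) + Real.sin t • rotGen a k x := rfl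

lemma norm_planeRot {a k : Fin 3} (h : a ≠ k) (t : ℝ) (x : E3) : ‖planeRot a k t x‖ = ‖x‖ := by
  rw [← sq_eq_sq₀ (norm_nonneg _) (norm_nonneg _), EuclideanSpace.real_norm_sq_eq,
    EuclideanSpace.real_norm_sq_eq, Fin.sum_univ_three, Fin.sum_univ_three]
  have := Real.sin_sq_add_cos_sq t
  fin_cases a <;> fin_cases k <;> simp [planeRot_apply, rotGen, e3] at h ⊢
  · linear_combination (x 0 ^ 2 + x 1 ^ 2) * this
  · linear_combination (x 0 ^ 2 + x 2 ^ 2) * this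
  · linear_combination (x 0 ^ 2 + x 1 ^ 2) * this
  · linear_combination (x 1 ^ 2 + x 2 ^ 2) * this
  · linear_combination (x 0 ^ 2 + x 2 ^ 2) * this
  · linear_combination (x 1 ^ 2 + x 2 ^ 2) * this

lemma hasDerivAt_planeRot {a k : Fin 3} (h : a ≠ k) (t : ℝ) (x : E3) :
    HasDerivAt (fun s => planeRot a k s x) (rotGen a k (planeRot a k t x)) t := by
  have h1 : HasDerivAt (fun s => planeRot a k s x)
      ((-Real.sin t) • (x a • e3 a + x k • e3 k) + Real.cos t • rotGen a k x) t :=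
    ((((Real.hasDerivAt_cos t).sub_const 1).smul_const _).const_add x).add
      ((Real.hasDerivAt_sin t).smul_const _)
  convert h1 using 1
  ext i
  fin_cases a <;> fin_cases k <;> fin_cases i <;> simp [planeRot_apply, rotGen, e3] at h ⊢ <;> ring

lemma setIntegral_comp_planeRot {a k : Fin 3} (h : a ≠ k) (t : ℝ) (f : E3 → ℝ) :
    ∫ x in Metric.sphere (0 : E3) 1, f (planeRot a k t x) ∂μH[2] =
      ∫ x in Metric.sphere (0 : E3) 1, f x ∂μH[2] := by
  let e : E3 ≃ᵢ E3 := (LinearIsometry.toLinearIsometryEquiv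
    ⟨planeRot a k t, norm_planeRot h t⟩ rfl).toIsometryEquiv
  have := (e.measurePreserving_hausdorffMeasure 2).setIntegral_preimage_emb
    e.toHomeomorph.measurableEmbedding f (Metric.sphere 0 1)
  rw [← this]
  congr 2
  ext x
  have : ‖e x‖ = ‖x‖ := norm_planeRot h t x
  rw [Set.mem_preimage, mem_sphere_zero_iff_norm, mem_sphere_zero_iff_norm, this]

lemma integral_fderiv_rotGen {f : E3 → ℝ} (hf : ContDiffOn ℝ (⊤ : ℕ∞) f {(0 : E3)}ᶜ)
    (a k : Fin 3) :
    ∫ x in Metric.sphere (0 : E3) 1, fderiv ℝ f x (rotGen a k x) ∂μH[2] = 0 := by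
  rcases eq_or_ne a k with rfl | h
  · simp [rotGen]
  have hcont : ContinuousOn (fun x => fderiv ℝ f x (rotGen a k x)) {(0 : E3)}ᶜ := by
    refine (hf.continuousOn_fderiv_of_isOpen isOpen_compl_singleton (by simp)).clm_apply ?_
    unfold rotGen
    fun_prop
  have hmem : ∀ t, ∀ x ∈ Metric.sphere (0 : E3) 1,
      planeRot a k t x ∈ Metric.sphere (0 : E3) 1 := by
    intro t x hx
    simpa [norm_planeRot h] using hx
  have hrc : ∀ t, Continuous (planeRot a k t) := fun t =>
    (planeRot a k t).continuous_of_finiteDimensional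
  have hsub : Metric.sphere (0 : E3) 1 ⊆ {0}ᶜ := fun x hx => ne_zero_of_mem_unitSphere hx
  obtain ⟨C, hC⟩ := isCompact_unitSphere.exists_bound_of_continuousOn (hcont.mono hsub)
  have hms : MeasurableSet (Metric.sphere (0 : E3) 1) := Metric.isClosed_sphere.measurableSet
  have h0 : ∀ x, planeRot a k 0 x = x := fun x => by simp [planeRot_apply]
  have key := (hasDerivAt_integral_of_dominated_loc_of_deriv_le (𝕜 := ℝ)
    (μ := μH[2].restrict (Metric.sphere (0 : E3) 1)) (s := Set.univ) (x₀ := (0 : ℝ))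
    (F := fun t x => f (planeRot a k t x))
    (F' := fun t x => fderiv ℝ f (planeRot a k t x) (rotGen a k (planeRot a k t x)))
    (bound := fun _ => C) Filter.univ_mem
    (Filter.Eventually.of_forall fun t => ((hf.continuousOn.mono hsub).comp
      (hrc t).continuousOn (hmem t)).aestronglyMeasurable hms)
    (by simp only [h0]; exact integrableOn_unitSphere hf.continuousOn)
    (by simpa only [h0] using (hcont.mono hsub).aestronglyMeasurable hms)
    (ae_restrict_of_forall_mem hms fun x hx t _ => hC _ (hmem t x hx))
    (integrable_const C)
    (ae_restrict_of_forall_mem hms fun x hx t _ => ?_)).2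
  · simp only [setIntegral_comp_planeRot h, h0] at key
    exact key.unique (hasDerivAt_const _ _)
  · have hd : DifferentiableAt ℝ f (planeRot a k t x) :=
      (hf.differentiableOn (by simp)).differentiableAt
        (isOpen_compl_singleton.mem_nhds (hsub (hmem t x hx)))
    exact hd.hasFDerivAt.comp_hasDerivAt t (hasDerivAt_planeRot h t x)

/-- Smoothness away from the origin. -/
abbrev SmoothOff0 (u : E3 → ℝ) : Prop := ContDiffOn ℝ (⊤ : ℕ∞) u {(0 : E3)}ᶜ

/-- The `i`-th partial derivative, set to `0` at the origin so that partial derivatives of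
functions which are smooth away from the origin commute everywhere. -/
def pd (i : Fin 3) (u : E3 → ℝ) (x : E3) : ℝ :=
  open Classical in if x = 0 then 0 else fderiv ℝ u x (e3 i)

section PartialDerivatives

variable {u v : E3 → ℝ} {x : E3}

lemma pd_of_ne (i : Fin 3) (u : E3 → ℝ) (hx : x ≠ 0) : pd i u x = fderiv ℝ u x (e3 i) :=
  if_neg hx

lemma SmoothOff0.contDiffAt (hu : SmoothOff0 u) (hx : x ≠ 0) : ContDiffAt ℝ (⊤ : ℕ∞) u x :=
  ContDiffOn.contDiffAt hu (isOpen_compl_singleton.mem_nhds hx)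

lemma SmoothOff0.differentiableAt (hu : SmoothOff0 u) (hx : x ≠ 0) : DifferentiableAt ℝ u x :=
  (hu.contDiffAt hx).differentiableAt (by simp)

lemma SmoothOff0.pd (hu : SmoothOff0 u) (i : Fin 3) : SmoothOff0 (pd i u) :=
  ((ContDiffOn.fderiv_of_isOpen hu isOpen_compl_singleton (m := (⊤ : ℕ∞)) (by simp)).clm_apply
    contDiffOn_const).congr fun _ hx => pd_of_ne i u hx

lemma SmoothOff0.coord (i : Fin 3) : SmoothOff0 (fun x => x i) := by
  unfold SmoothOff0
  fun_prop

lemma pd_eq_of_eqOn (h : ∀ y ≠ 0, u y = v y) (i : Fin 3) : pd i u = pd i v := by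
  funext x
  by_cases hx : x = 0
  · simp [pd, hx]
  · have : u =ᶠ[nhds x] v :=
      Filter.eventually_of_mem (isOpen_compl_singleton.mem_nhds hx) fun y hy => h y hy
    rw [pd_of_ne i u hx, pd_of_ne i v hx, this.fderiv_eq]

lemma pd_add (hu : SmoothOff0 u) (hv : SmoothOff0 v) (i : Fin 3) (hx : x ≠ 0) :
    pd i (fun y => u y + v y) x = pd i u x + pd i v x := by
  simp only [pd_of_ne i _ hx]
  rw [fderiv_fun_add (hu.differentiableAt hx) (hv.differentiableAt hx)]
  rfl

lemma pd_mul (hu : SmoothOff0 u) (hv : SmoothOff0 v) (i : Fin 3) (hx : x ≠ 0) :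
    pd i (fun y => u y * v y) x = pd i u x * v x + u x * pd i v x := by
  simp only [pd_of_ne i _ hx]
  rw [fderiv_fun_mul (hu.differentiableAt hx) (hv.differentiableAt hx)]
  simp
  ring

lemma pd_const_mul (hu : SmoothOff0 u) (c : ℝ) (i : Fin 3) (hx : x ≠ 0) :
    pd i (fun y => c * u y) x = c * pd i u x := by
  simp only [pd_of_ne i _ hx]
  rw [fderiv_const_mul (hu.differentiableAt hx)]
  rfl

lemma pd_coord (i j : Fin 3) (hx : x ≠ 0) :
    pd i (fun y => y j) x = if i = j then 1 else 0 := by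
  rw [pd_of_ne i _ hx]
  have : HasFDerivAt (fun y : E3 => y j) (EuclideanSpace.proj j : E3 →L[ℝ] ℝ) x :=
    (EuclideanSpace.proj j : E3 →L[ℝ] ℝ).hasFDerivAt
  rw [this.fderiv]
  simp [e3, eq_comm]

lemma fderiv_fderiv_eq_pd_pd (hu : SmoothOff0 u) (i j : Fin 3) (hx : x ≠ 0) :
    fderiv ℝ (fderiv ℝ u) x (e3 i) (e3 j) = pd i (pd j u) x := by
  have h : pd j u =ᶠ[nhds x] fun y => fderiv ℝ u y (e3 j) :=
    Filter.eventually_of_mem (isOpen_compl_singleton.mem_nhds hx) fun y hy => pd_of_ne j u hy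
  have hd : DifferentiableAt ℝ (fderiv ℝ u) x :=
    ((hu.contDiffAt hx).fderiv_right (m := 1) (by norm_cast)).differentiableAt (by simp)
  rw [pd_of_ne i _ hx, h.fderiv_eq, fderiv_clm_apply hd (by fun_prop)]
  simp

lemma pd_comm (hu : SmoothOff0 u) (i j : Fin 3) : pd i (pd j u) = pd j (pd i u) := by
  funext x
  by_cases hx : x = 0
  · simp [pd, hx]
  · rw [← fderiv_fderiv_eq_pd_pd hu i j hx, ← fderiv_fderiv_eq_pd_pd hu j i hx]
    exact (hu.contDiffAt hx).isSymmSndFDerivAt (by simp; norm_cast) _ _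

lemma hess3_eq_pd (hu : SmoothOff0 u) (i j : Fin 3) (hx : x ≠ 0) :
    hess3 u x i j = pd i (pd j u) x := by
  rw [← fderiv_fderiv_eq_pd_pd hu i j hx]
  simp [hess3, iteratedFDeriv_two_apply]

lemma lap3_eq_pd (hu : SmoothOff0 u) (hx : x ≠ 0) : lap3 u x = ∑ i, pd i (pd i u) x :=
  Finset.sum_congr rfl fun i _ => hess3_eq_pd hu i i hx

/-- Euler's relation for functions homogeneous of degree `k`. -/
def Euler (k : ℝ) (u : E3 → ℝ) : Prop :=
  ∀ x : E3, x ≠ 0 → x 0 * pd 0 u x + x 1 * pd 1 u x + x 2 * pd 2 u x = k * u x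

lemma fderiv_eq_sum_pd (u : E3 → ℝ) (hx : x ≠ 0) (w : E3) :
    fderiv ℝ u x w = w 0 * pd 0 u x + w 1 * pd 1 u x + w 2 * pd 2 u x := by
  have : w = w 0 • e3 0 + w 1 • e3 1 + w 2 • e3 2 := by
    ext i
    fin_cases i <;> simp [e3]
  conv_lhs => rw [this]
  simp [pd_of_ne _ _ hx]

lemma Homog0.euler (h : Homog0 u) (hu : SmoothOff0 u) : Euler 0 u := by
  intro x hx
  rw [← fderiv_eq_sum_pd u hx, zero_mul]
  have hl : HasDerivAt (fun c : ℝ => c • x) x 1 := by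
    simpa using (hasDerivAt_id (1 : ℝ)).smul_const x
  have hd : HasFDerivAt u (fderiv ℝ u x) ((1 : ℝ) • x) := by
    simpa using (hu.differentiableAt hx).hasFDerivAt
  have h1 := hd.comp_hasDerivAt (1 : ℝ) hl
  refine h1.unique ((hasDerivAt_const (1 : ℝ) (u x)).congr_of_eventuallyEq ?_)
  filter_upwards [lt_mem_nhds (zero_lt_one (α := ℝ))] with c hc using h c hc x hx

lemma Euler.pd {k : ℝ} (h : Euler k u) (hu : SmoothOff0 u) (i : Fin 3) :
    Euler (k - 1) (pd i u) := by
  intro x hx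
  have hs : ∀ j, SmoothOff0 fun y => y j * _root_.pd j u y := fun j =>
    ContDiffOn.mul (SmoothOff0.coord j) (hu.pd j)
  have h1 := congrFun (pd_eq_of_eqOn h i) x
  rw [pd_add (ContDiffOn.add (hs 0) (hs 1)) (hs 2) i hx, pd_add (hs 0) (hs 1) i hx,
    pd_const_mul hu k i hx, pd_mul (SmoothOff0.coord 0) (hu.pd 0) i hx,
    pd_mul (SmoothOff0.coord 1) (hu.pd 1) i hx, pd_mul (SmoothOff0.coord 2) (hu.pd 2) i hx,
    pd_coord _ _ hx, pd_coord _ _ hx, pd_coord _ _ hx, pd_comm hu i 0, pd_comm hu i 1,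
    pd_comm hu i 2] at h1
  fin_cases i <;> simp at h1 ⊢ <;> linear_combination h1

lemma Euler.coord_mul {k : ℝ} (h : Euler k u) (hu : SmoothOff0 u) (a : Fin 3) :
    Euler (k + 1) (fun y => y a * u y) := by
  intro x hx
  simp only [pd_mul (SmoothOff0.coord a) hu _ hx, pd_coord _ _ hx]
  have := h x hx
  fin_cases a <;> simp
  · linear_combination x 0 * this
  · linear_combination x 1 * this
  · linear_combination x 2 * this

end PartialDerivatives

/-- A function which is integrable on the unit sphere with vanishing integral. -/
def NullOnSphere (f : E3 → ℝ) : Prop :=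
  IntegrableOn f (Metric.sphere (0 : E3) 1) μH[2] ∧
    ∫ x in Metric.sphere (0 : E3) 1, f x ∂μH[2] = 0

namespace NullOnSphere

variable {f g : E3 → ℝ}

lemma add (hf : NullOnSphere f) (hg : NullOnSphere g) : NullOnSphere fun x => f x + g x :=
  ⟨hf.1.add hg.1, by rw [integral_add hf.1 hg.1, hf.2, hg.2, add_zero]⟩

lemma const_mul (c : ℝ) (hf : NullOnSphere f) : NullOnSphere fun x => c * f x :=
  ⟨hf.1.const_mul c, by rw [integral_const_mul, hf.2, mul_zero]⟩

lemma congr (hf : NullOnSphere f) (h : ∀ x ∈ Metric.sphere (0 : E3) 1, g x = f x) :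
    NullOnSphere g := by
  have hms : MeasurableSet (Metric.sphere (0 : E3) 1) := Metric.isClosed_sphere.measurableSet
  exact ⟨hf.1.congr_fun (fun x hx => (h x hx).symm) hms, (setIntegral_congr_fun hms h).trans hf.2⟩

lemma sum {ι : Type*} {s : Finset ι} {F : ι → E3 → ℝ} (h : ∀ i ∈ s, NullOnSphere (F i)) :
    NullOnSphere fun x => ∑ i ∈ s, F i x :=
  ⟨integrable_finsetSum s fun i hi => (h i hi).1, by
    rw [integral_finsetSum s fun i hi => (h i hi).1]
    exact Finset.sum_eq_zero fun i hi => (h i hi).2⟩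

lemma rotation (hf : SmoothOff0 f) (a k : Fin 3) :
    NullOnSphere fun x => x a * pd k f x - x k * pd a f x := by
  have hs : SmoothOff0 fun x => x a * pd k f x - x k * pd a f x :=
    ContDiffOn.sub (ContDiffOn.mul (SmoothOff0.coord a) (hf.pd k))
      (ContDiffOn.mul (SmoothOff0.coord k) (hf.pd a))
  refine ⟨integrableOn_unitSphere hs.continuousOn, ?_⟩
  rw [← integral_fderiv_rotGen hf a k]
  refine setIntegral_congr_fun Metric.isClosed_sphere.measurableSet fun x hx => ?_
  have hx0 := ne_zero_of_mem_unitSphere hx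
  simp [rotGen, pd_of_ne _ _ hx0]

lemma rotation_mul (hf : SmoothOff0 f) (hg : SmoothOff0 g) (a k : Fin 3) :
    NullOnSphere fun x => x a * (pd k f x * g x + f x * pd k g x) -
      x k * (pd a f x * g x + f x * pd a g x) :=
  (rotation (ContDiffOn.mul hf hg) a k).congr fun x hx => by
    have hx0 := ne_zero_of_mem_unitSphere hx
    rw [pd_mul hf hg k hx0, pd_mul hf hg a hx0]

/-- The divergence theorem on the sphere for a field with one homogeneous component. -/
lemma divergence (hf : SmoothOff0 f) {k : ℝ} (h : Euler k f) (i : Fin 3) :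
    NullOnSphere fun x => pd i f x - (k + 2) * (x i * f x) := by
  have hr : ∀ a, NullOnSphere _ := fun a => rotation_mul (SmoothOff0.coord a) hf a i
  refine (((hr 0).add (hr 1)).add (hr 2)).congr fun x hx => ?_
  have hx0 := ne_zero_of_mem_unitSphere hx
  have hE := h x hx0
  have h1 := sum_sq_of_mem_unitSphere hx
  simp only [pd_coord _ _ hx0]
  fin_cases i <;> simp
  · linear_combination x 0 * hE - pd 0 f x * h1
  · linear_combination x 1 * hE - pd 1 f x * h1
  · linear_combination x 2 * hE - pd 2 f x * h1

lemma divergence_mul (hf : SmoothOff0 f) (hg : SmoothOff0 g) {k l : ℝ} (h : Euler k f)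
    (h' : Euler l g) (i : Fin 3) :
    NullOnSphere fun x => pd i f x * g x + f x * pd i g x - (k + l + 2) * (x i * (f x * g x)) := by
  have hE : Euler (k + l) fun x => f x * g x := fun x hx => by
    simp only [pd_mul hf hg _ hx]
    linear_combination g x * h x hx + f x * h' x hx
  refine (divergence (ContDiffOn.mul hf hg) hE i).congr fun x hx => ?_
  rw [pd_mul hf hg i (ne_zero_of_mem_unitSphere hx)]

end NullOnSphere

section TangentialMatrices

variable {x : E3}

lemma transpose_proj3 (x : E3) : (proj3 x)ᵀ = proj3 x := by
  ext i j
  fin_cases i <;> fin_cases j <;> simp [proj3] <;> ring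

lemma transpose_crossMat (x : E3) : (crossMat x)ᵀ = -crossMat x := by
  ext i j
  fin_cases i <;> fin_cases j <;> simp [crossMat]

lemma trace_crossMat (x : E3) : (crossMat x).trace = 0 := by
  simp [crossMat, Matrix.trace, Fin.sum_univ_three]

lemma trace_crossMat_mul {K : Matrix (Fin 3) (Fin 3) ℝ} (hK : Kᵀ = K) :
    (crossMat x * K).trace = 0 := by
  have h : (crossMat x * K).trace = -(crossMat x * K).trace := by
    conv_lhs => rw [← Matrix.trace_transpose, Matrix.transpose_mul, transpose_crossMat, hK,
      Matrix.mul_neg, Matrix.trace_neg, Matrix.trace_mul_comm]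
  linarith

lemma crossMat_mul_self (hx : x ∈ Metric.sphere (0 : E3) 1) :
    crossMat x * crossMat x = -proj3 x := by
  have h := sum_sq_of_mem_unitSphere hx
  ext i j
  fin_cases i <;> fin_cases j <;> simp [crossMat, proj3, Matrix.mul_apply, Fin.sum_univ_three] <;>
    linarith

lemma trace_proj3 (hx : x ∈ Metric.sphere (0 : E3) 1) : (proj3 x).trace = 2 := by
  have h := sum_sq_of_mem_unitSphere hx
  simp [proj3, Matrix.trace, Fin.sum_univ_three]
  linarith

lemma crossMat_mul_proj3 (x : E3) : crossMat x * proj3 x = crossMat x := by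
  ext i j
  fin_cases i <;> fin_cases j <;>
    simp [crossMat, proj3, Matrix.mul_apply, Fin.sum_univ_three] <;> ring

lemma mul_proj3 {H : Matrix (Fin 3) (Fin 3) ℝ} (h : H *ᵥ x.ofLp = 0) : H * proj3 x = H := by
  have : (Matrix.of fun i j => x i * x j) = Matrix.vecMulVec x.ofLp x.ofLp := rfl
  rw [proj3, this, Matrix.mul_sub, Matrix.mul_one, Matrix.mul_vecMulVec, h]
  simp

/-- Cayley-Hamilton for the composition of a tangential symmetric form with the quarter turn. -/
lemma mul_crossMat {K : Matrix (Fin 3) (Fin 3) ℝ} (hK : Kᵀ = K) (h : K *ᵥ x.ofLp = 0) :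
    K * crossMat x = K.trace • crossMat x - crossMat x * K := by
  have hs : ∀ i j, K i j = K j i := fun i j => congrFun (congrFun hK j) i
  have h0 := congrFun h 0
  have h1 := congrFun h 1
  have h2 := congrFun h 2
  simp [Matrix.mulVec, dotProduct, Fin.sum_univ_three] at h0 h1 h2
  rw [hs 1 0] at h1
  rw [hs 2 0, hs 2 1] at h2
  ext i j
  fin_cases i <;> fin_cases j <;>
    simp [crossMat, Matrix.mul_apply, Matrix.trace, Matrix.vecMul, dotProduct,
      Fin.sum_univ_three, hs 1 0, hs 2 0, hs 2 1] <;>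
    first
    | ring1
    | linear_combination h0
    | linear_combination -h0
    | linear_combination h1
    | linear_combination -h1
    | linear_combination h2
    | linear_combination -h2

lemma trace_mul_transpose_of_tangential {H K : Matrix (Fin 3) (Fin 3) ℝ}
    (hx : x ∈ Metric.sphere (0 : E3) 1) (hH : Hᵀ = H) (hK : Kᵀ = K) (hHx : H *ᵥ x.ofLp = 0)
    (hKx : K *ᵥ x.ofLp = 0) (M : Matrix (Fin 3) (Fin 3) ℝ)
    (hM : M = H - (1 / 2 * H.trace) • proj3 x +
      (1 / 2 : ℝ) • (crossMat x * K - K * crossMat x)) :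
    (M * Mᵀ).trace = (H * H).trace - 1 / 2 * H.trace ^ 2 + ((K * K).trace - 1 / 2 * K.trace ^ 2) +
      2 * (H * crossMat x * K).trace := by
  set J := crossMat x with hJ
  set P := proj3 x with hP
  have hB : (1 / 2 : ℝ) • (J * K - K * J) = J * K - (1 / 2 * K.trace) • J := by
    rw [mul_crossMat hK hKx]
    module
  have hBt : (J * K - (1 / 2 * K.trace) • J)ᵀ = J * K - (1 / 2 * K.trace) • J := by
    rw [← hB]
    simp only [Matrix.transpose_smul, Matrix.transpose_sub, Matrix.transpose_mul, hK, hJ,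
      transpose_crossMat]
    simp only [Matrix.mul_neg, Matrix.neg_mul]
    module
  have hPt : Pᵀ = P := transpose_proj3 x
  have hHP : H * P = H := mul_proj3 hHx
  have hPH : P * H = H := by
    rw [← hPt, ← hH, ← Matrix.transpose_mul, hHP]
  have hKP : K * P = K := mul_proj3 hKx
  have hPK : P * K = K := by
    rw [← hPt, ← hK, ← Matrix.transpose_mul, hKP]
  have hJJ : J * J = -P := crossMat_mul_self hx
  have hJP : J * P = J := crossMat_mul_proj3 x
  have hPJ : P * J = J := by
    have := congrArg Matrix.transpose hJP
    simpa [Matrix.transpose_mul, hPt, hJ, transpose_crossMat] using this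
  have hPP : P * P = P := by
    have : J * J * P = J * J := by rw [Matrix.mul_assoc, hJP]
    rw [hJJ] at this
    simpa using this
  have hPtr : P.trace = 2 := trace_proj3 hx
  have hJtr : J.trace = 0 := trace_crossMat x
  have hJK : (J * K).trace = 0 := trace_crossMat_mul hK
  have hHJ : (H * J).trace = 0 := by
    rw [Matrix.trace_mul_comm]
    exact trace_crossMat_mul hH
  have hAA : ((H - (1 / 2 * H.trace) • P) * (H - (1 / 2 * H.trace) • P)).trace =
      (H * H).trace - 1 / 2 * H.trace ^ 2 := by
    simp only [Matrix.mul_sub, Matrix.sub_mul, Matrix.smul_mul, Matrix.mul_smul, hHP, hPH, hPP,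
      Matrix.trace_sub, Matrix.trace_smul, hPtr, smul_eq_mul]
    ring
  have hAB : ((H - (1 / 2 * H.trace) • P) * (J * K - (1 / 2 * K.trace) • J)).trace =
      (H * J * K).trace := by
    simp only [Matrix.mul_sub, Matrix.sub_mul, Matrix.smul_mul, Matrix.mul_smul,
      ← Matrix.mul_assoc, hPJ, Matrix.trace_sub, Matrix.trace_smul, hJK, hHJ, hJtr, smul_eq_mul]
    ring
  have hJKJ : J * K * J = K.trace • (-P) + P * K := by
    rw [Matrix.mul_assoc, mul_crossMat hK hKx, Matrix.mul_sub, Matrix.mul_smul, ← Matrix.mul_assoc,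
      hJJ]
    simp
  have hBB : ((J * K - (1 / 2 * K.trace) • J) * (J * K - (1 / 2 * K.trace) • J)).trace =
      (K * K).trace - 1 / 2 * K.trace ^ 2 := by
    simp only [Matrix.mul_sub, Matrix.sub_mul, Matrix.smul_mul, Matrix.mul_smul,
      ← Matrix.mul_assoc, hJKJ, hJJ, hPK, Matrix.add_mul, Matrix.neg_mul, Matrix.trace_neg,
      Matrix.trace_add, Matrix.trace_sub, Matrix.trace_smul, hPtr, smul_eq_mul]
    ring
  rw [hM, hB, Matrix.transpose_add, hBt, Matrix.transpose_sub, hH, Matrix.transpose_smul, hPt,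
    Matrix.mul_add, Matrix.add_mul, Matrix.add_mul, Matrix.trace_add, Matrix.trace_add,
    Matrix.trace_add, hAA, hBB, hAB, Matrix.trace_mul_comm (J * K - _), hAB]
  ring

end TangentialMatrices

section SphereHessian

variable {u m : E3 → ℝ} {x : E3}

lemma Euler.pd_pd (h : Euler 0 u) (hu : SmoothOff0 u) (hx : x ≠ 0) (i : Fin 3) :
    x 0 * _root_.pd 0 (_root_.pd i u) x + x 1 * _root_.pd 1 (_root_.pd i u) x +
      x 2 * _root_.pd 2 (_root_.pd i u) x = - _root_.pd i u x := by
  linear_combination h.pd hu i x hx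

/-- The projected Hessian of a function homogeneous of degree `0`, in coordinates. -/
def tangentHess (u : E3 → ℝ) (x : E3) : Matrix (Fin 3) (Fin 3) ℝ :=
  Matrix.of fun i j => pd i (pd j u) x + x i * pd j u x + pd i u x * x j

lemma hessS_eq_tangentHess (hu : SmoothOff0 u) (h : Euler 0 u)
    (hx : x ∈ Metric.sphere (0 : E3) 1) : hessS u x = tangentHess u x := by
  have hx0 := ne_zero_of_mem_unitSphere hx
  have h0 := h x hx0
  set g : Fin 3 → ℝ := fun i => pd i u x with hg
  have hDx : hess3 u x *ᵥ x.ofLp = -g := by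
    ext i
    simp only [Matrix.mulVec, dotProduct, Fin.sum_univ_three, hess3_eq_pd hu _ _ hx0]
    rw [pd_comm hu i 0, pd_comm hu i 1, pd_comm hu i 2]
    simpa [mul_comm, hg] using h.pd_pd hu hx0 i
  have hxD : x.ofLp ᵥ* hess3 u x = -g := by
    ext i
    simp only [Matrix.vecMul, dotProduct, Fin.sum_univ_three, hess3_eq_pd hu _ _ hx0]
    exact h.pd_pd hu hx0 i
  have hgx : g ⬝ᵥ x.ofLp = 0 := by
    simp only [dotProduct, Fin.sum_univ_three, hg]
    linear_combination h0
  have hP : proj3 x = 1 - Matrix.vecMulVec x.ofLp x.ofLp := rfl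
  have hH : hessS u x = hess3 u x + Matrix.vecMulVec x.ofLp g + Matrix.vecMulVec g x.ofLp := by
    rw [hessS, hP, Matrix.sub_mul, Matrix.one_mul, Matrix.vecMulVec_mul, hxD, Matrix.mul_sub,
      Matrix.mul_one, Matrix.sub_mul, Matrix.mul_vecMulVec, hDx, Matrix.vecMulVec_mul_vecMulVec]
    simp [hgx, Matrix.vecMulVec_neg, Matrix.neg_vecMulVec]
  rw [hH]
  ext i j
  simp [tangentHess, hess3_eq_pd hu i j hx0, Matrix.vecMulVec_apply, hg]

lemma transpose_tangentHess (hu : SmoothOff0 u) : (tangentHess u x)ᵀ = tangentHess u x := by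
  ext i j
  simp only [tangentHess, Matrix.transpose_apply, Matrix.of_apply, pd_comm hu j i]
  ring

lemma tangentHess_mulVec (hu : SmoothOff0 u) (h : Euler 0 u)
    (hx : x ∈ Metric.sphere (0 : E3) 1) : tangentHess u x *ᵥ x.ofLp = 0 := by
  have hx0 := ne_zero_of_mem_unitSphere hx
  have h1 := sum_sq_of_mem_unitSphere hx
  ext i
  have hi := h.pd_pd hu hx0 i
  simp only [tangentHess, Matrix.mulVec, dotProduct, Fin.sum_univ_three, Matrix.of_apply,
    Pi.zero_apply]
  rw [pd_comm hu i 0, pd_comm hu i 1, pd_comm hu i 2]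
  linear_combination hi + x i * h x hx0 + pd i u x * h1

lemma trace_tangentHess (hu : SmoothOff0 u) (h : Euler 0 u) (hx0 : x ≠ 0) :
    (tangentHess u x).trace = lap3 u x := by
  rw [lap3_eq_pd hu hx0]
  simp only [tangentHess, Matrix.trace, Matrix.diag, Fin.sum_univ_three, Matrix.of_apply]
  linear_combination 2 * h x hx0

lemma SmoothOff0.sum_pd_pd (hu : SmoothOff0 u) :
    SmoothOff0 fun x => ∑ i, _root_.pd i (_root_.pd i u) x :=
  ContDiffOn.sum fun i _ => (hu.pd i).pd i

lemma lap3_lap3_eq_pd (hu : SmoothOff0 u) (hx : x ≠ 0) :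
    lap3 (lap3 u) x = ∑ i, ∑ j, pd i (pd i (pd j (pd j u))) x := by
  have hs : SmoothOff0 (lap3 u) := hu.sum_pd_pd.congr fun y hy => lap3_eq_pd hu hy
  rw [lap3_eq_pd hs hx]
  refine Finset.sum_congr rfl fun i _ => ?_
  have hsum : ∀ (v : Fin 3 → E3 → ℝ), (∀ j, SmoothOff0 (v j)) → ∀ y ≠ 0,
      pd i (fun z => ∑ j, v j z) y = ∑ j, pd i (v j) y := by
    intro v hv y hy
    simp only [Fin.sum_univ_three]
    rw [pd_add (ContDiffOn.add (hv 0) (hv 1)) (hv 2) i hy, pd_add (hv 0) (hv 1) i hy]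
  rw [pd_eq_of_eqOn (fun y hy => lap3_eq_pd hu hy) i,
    pd_eq_of_eqOn (hsum _ fun j => (hu.pd j).pd j) i, hsum _ (fun j => ((hu.pd j).pd j).pd i) x hx]

/-- The Bochner identity on the sphere for functions homogeneous of degree `0`. -/
lemma nullOnSphere_bochner (hu : SmoothOff0 u) (h : Euler 0 u) :
    NullOnSphere fun x => (tangentHess u x * tangentHess u x).trace -
      1 / 2 * (tangentHess u x).trace ^ 2 - 1 / 2 * (u x * lap3 (lap3 u) x) := by
  have A : NullOnSphere fun x => ∑ i, ∑ j, (pd i (pd j u) x * pd i (pd j u) x +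
      pd j u x * pd j (pd i (pd i u)) x + x i * (pd j u x * pd i (pd j u) x)) :=
    .sum fun i _ => .sum fun j _ => (NullOnSphere.divergence_mul (hu.pd j) ((hu.pd i).pd j)
      (h.pd hu j) ((h.pd hu i).pd (hu.pd i) j) i).congr fun x _ => by
        rw [pd_comm (hu.pd i) i j, pd_comm hu i j]
        ring
  have B : NullOnSphere fun x => ∑ i, ∑ j, _ :=
    .sum fun i _ => .sum fun j _ => NullOnSphere.divergence_mul (hu.pd i) ((hu.pd j).pd j)
      (h.pd hu i) ((h.pd hu j).pd (hu.pd j) j) i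
  have C : NullOnSphere fun x => ∑ i, ∑ j, _ :=
    .sum fun i _ => .sum fun j _ => NullOnSphere.divergence_mul hu (((hu.pd j).pd j).pd i)
      h (((h.pd hu j).pd (hu.pd j) j).pd ((hu.pd j).pd j) i) i
  have D : NullOnSphere fun x => ∑ i, _ :=
    .sum fun i _ => NullOnSphere.divergence_mul hu (hu.pd i) h (h.pd hu i) i
  refine (((A.add (B.const_mul (-1 / 2))).add (C.const_mul (-1 / 2))).add
    (D.const_mul (-1))).congr fun x hx => ?_
  have hx0 := ne_zero_of_mem_unitSphere hx
  have h1 := sum_sq_of_mem_unitSphere hx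
  have e := h x hx0
  have e0 := h.pd_pd hu hx0 0
  have e1 := h.pd_pd hu hx0 1
  have e2 := h.pd_pd hu hx0 2
  have q := fun j => (h.pd hu j).pd (hu.pd j) j x hx0
  have q0 := q 0
  have q1 := q 1
  have q2 := q 2
  rw [trace_tangentHess hu h hx0, lap3_lap3_eq_pd hu hx0, lap3_eq_pd hu hx0]
  simp only [tangentHess, Matrix.trace, Matrix.diag, Matrix.mul_apply, Fin.sum_univ_three,
    Matrix.of_apply]
  rw [pd_comm hu 1 0, pd_comm hu 2 0] at *
  rw [pd_comm hu 2 1] at *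
  linear_combination 3 * (pd 0 u x * e0 + pd 1 u x * e1 + pd 2 u x * e2) +
    2 * (x 0 * pd 0 u x + x 1 * pd 1 u x + x 2 * pd 2 u x) * e +
    2 * (pd 0 u x ^ 2 + pd 1 u x ^ 2 + pd 2 u x ^ 2) * h1 +
    1 / 2 * (pd 0 (pd 0 u) x + pd 1 (pd 1 u) x + pd 2 (pd 2 u) x) * e +
    1 / 2 * u x * (q0 + q1 + q2) - u x * e

/-- The flux of the curl of `q ∇ u` through the sphere vanishes. -/
lemma nullOnSphere_curl {q : E3 → ℝ} (hu : SmoothOff0 u) (hq : SmoothOff0 q) :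
    NullOnSphere fun x => pd 0 u x * (x 1 * pd 2 q x - x 2 * pd 1 q x) +
      pd 1 u x * (x 2 * pd 0 q x - x 0 * pd 2 q x) +
      pd 2 u x * (x 0 * pd 1 q x - x 1 * pd 0 q x) := by
  refine (((NullOnSphere.rotation_mul hq (hu.pd 0) 1 2).add
    (NullOnSphere.rotation_mul hq (hu.pd 1) 2 0)).add
    (NullOnSphere.rotation_mul hq (hu.pd 2) 0 1)).congr fun x _ => ?_
  rw [pd_comm hu 1 0, pd_comm hu 2 0, pd_comm hu 2 1]
  ring

/-- The closed and co-closed parts are orthogonal. -/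
lemma nullOnSphere_cross (hu : SmoothOff0 u) (h : Euler 0 u) (hm : SmoothOff0 m)
    (h' : Euler 0 m) :
    NullOnSphere fun x => (tangentHess u x * crossMat x * tangentHess m x).trace := by
  have C : ∀ j a k, NullOnSphere fun x => ∑ i, (pd i (pd j u) x * (x a * pd k (pd i m) x) +
      pd j u x * ((if i = a then 1 else 0) * pd k (pd i m) x + x a * pd k (pd i (pd i m)) x)) :=
    fun j a k => .sum fun i _ => (NullOnSphere.divergence_mul (hu.pd j)
      (ContDiffOn.mul (SmoothOff0.coord a) ((hm.pd i).pd k)) (h.pd hu j)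
      (((h'.pd hm i).pd (hm.pd i) k).coord_mul ((hm.pd i).pd k) a) i).congr fun x hx => by
        have hx0 := ne_zero_of_mem_unitSphere hx
        rw [pd_mul (SmoothOff0.coord a) ((hm.pd i).pd k) i hx0, pd_coord i a hx0,
          pd_comm (hm.pd i) i k]
        ring
  have R : NullOnSphere fun x => ∑ i, _ :=
    .sum fun i (_ : i ∈ Finset.univ) => nullOnSphere_curl hu ((hm.pd i).pd i)
  refine ((((((((C 0 1 2).add (C 1 2 0)).add (C 2 0 1)).add ((C 0 2 1).const_mul (-1))).add
    ((C 1 0 2).const_mul (-1))).add ((C 2 1 0).const_mul (-1))).add (R.const_mul (-1))).add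
    ((nullOnSphere_curl hu hm).const_mul (-1))).congr fun x hx => ?_
  have hx0 := ne_zero_of_mem_unitSphere hx
  have h1 := sum_sq_of_mem_unitSphere hx
  have e0 := h.pd_pd hu hx0 0
  have e1 := h.pd_pd hu hx0 1
  have e2 := h.pd_pd hu hx0 2
  have f0 := h'.pd_pd hm hx0 0
  have f1 := h'.pd_pd hm hx0 1
  have f2 := h'.pd_pd hm hx0 2
  simp [tangentHess, Matrix.trace, Matrix.mul_apply, Fin.sum_univ_three, crossMat]
  rw [pd_comm hu 1 0, pd_comm hu 2 0, pd_comm hm 1 0, pd_comm hm 2 0] at *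
  rw [pd_comm hu 2 1, pd_comm hm 2 1] at *
  linear_combination
    (x 1 * pd 2 m x - x 2 * pd 1 m x) * (e0 + pd 0 u x * h1) +
    (x 2 * pd 0 m x - x 0 * pd 2 m x) * (e1 + pd 1 u x * h1) +
    (x 0 * pd 1 m x - x 1 * pd 0 m x) * (e2 + pd 2 u x * h1) -
    (x 1 * pd 2 u x - x 2 * pd 1 u x) * f0 -
    (x 2 * pd 0 u x - x 0 * pd 2 u x) * f1 -
    (x 0 * pd 1 u x - x 1 * pd 0 u x) * f2

lemma integrableOn_mul_lap3_lap3 (hu : SmoothOff0 u) :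
    IntegrableOn (fun x => u x * lap3 (lap3 u) x) (Metric.sphere (0 : E3) 1) μH[2] := by
  have hs : SmoothOff0 fun x => u x * ∑ i, ∑ j, pd i (pd i (pd j (pd j u))) x :=
    ContDiffOn.mul hu (ContDiffOn.sum fun i _ => ContDiffOn.sum fun j _ =>
      (((hu.pd j).pd j).pd i).pd i)
  refine (integrableOn_unitSphere hs.continuousOn).congr_fun (fun x hx => ?_)
    Metric.isClosed_sphere.measurableSet
  simp only [lap3_lap3_eq_pd hu (ne_zero_of_mem_unitSphere hx)]

end SphereHessian

/-- for smooth degree-0 homogeneous n, n̄ on ℝ³∖{0},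
∫_{S²} tr(M Mᵀ) dS = (1/2) ∫_{S²} (n Δ(Δn) + n̄ Δ(Δn̄)) dS. -/
theorem integral_news_square (n nb : E3 → ℝ)
    (hn : ContDiffOn ℝ (⊤ : ℕ∞) n {(0:E3)}ᶜ) (hnb : ContDiffOn ℝ (⊤ : ℕ∞) nb {(0:E3)}ᶜ)
    (hn0 : Homog0 n) (hnb0 : Homog0 nb) :
    ∫ x in Metric.sphere (0:E3) 1,
        (newsMat n nb x * (newsMat n nb x)ᵀ).trace ∂(μH[2]) =
    (1 / 2) * ∫ x in Metric.sphere (0:E3) 1,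
        (n x * lap3 (lap3 n) x + nb x * lap3 (lap3 nb) x) ∂(μH[2]) := by
  have hE := hn0.euler hn
  have hEb := hnb0.euler hnb
  have N := ((nullOnSphere_bochner hn hE).add (nullOnSphere_bochner hnb hEb)).add
    ((nullOnSphere_cross hn hE hnb hEb).const_mul 2)
  have hI := (integrableOn_mul_lap3_lap3 hn).add (integrableOn_mul_lap3_lap3 hnb)
  have hms : MeasurableSet (Metric.sphere (0 : E3) 1) := Metric.isClosed_sphere.measurableSet
  refine (setIntegral_congr_fun hms fun x hx => ?_).trans
    ((integral_add N.1 (hI.const_mul (1 / 2))).trans ?_)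
  swap
  · rw [N.2, zero_add, integral_const_mul]
    rfl
  have hx0 := ne_zero_of_mem_unitSphere hx
  have hM : newsMat n nb x = tangentHess n x - (1 / 2 * (tangentHess n x).trace) • proj3 x +
      (1 / 2 : ℝ) • (crossMat x * tangentHess nb x - tangentHess nb x * crossMat x) := by
    rw [newsMat, hessS_eq_tangentHess hn hE hx, hessS_eq_tangentHess hnb hEb hx,
      trace_tangentHess hn hE hx0]
  have T := trace_mul_transpose_of_tangential hx (transpose_tangentHess hn)
    (transpose_tangentHess hnb) (tangentHess_mulVec hn hE hx) (tangentHess_mulVec hnb hEb hx) _ hM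
  simp only [T, Pi.add_apply]
  ring
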